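/- Sharpness of the O(N log N) estimate: There exists a sequence (a_n)_{n≥1} of nonnegative reals such that the Dirichlet series f(x) = ∑_{n=1}^∞ a_n/n^x converges for all real x > 1 with f(x) = O(1/(x−1)) as x ↘ 1, while the partial sums s_N = ∑_{n ≤ N} a_n satisfy limsup_{N→∞} s_N/(N log N) ≥ 1/log 2 > 0. Hence the estimate s_N = O(N log N) implied by the real condition f(x) = O(1/(x−1)) is best possible. -/

import Mathlib

open Filter Finset

noncomputable def shA (n : ℕ) : ℝ :=
  Function.extend (fun k : ℕ => 2 ^ 2 ^ k) (fun k : ℕ => (2 : ℝ) ^ 2 ^ k * 2 ^ k) 0 n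

lemma sh_inj : Function.Injective (fun k : ℕ => 2 ^ 2 ^ k : ℕ → ℕ) := by
  intro a b h
  exact Nat.pow_right_injective le_rfl (Nat.pow_right_injective le_rfl h)

lemma shA_apply (k : ℕ) : shA (2 ^ 2 ^ k) = (2 : ℝ) ^ 2 ^ k * 2 ^ k :=
  sh_inj.extend_apply _ _ k

lemma shA_zero (n : ℕ) (h : n ∉ Set.range (fun k : ℕ => 2 ^ 2 ^ k : ℕ → ℕ)) : shA n = 0 := by
  unfold shA
  rw [Function.extend_apply' _ _ _ (by simpa using h)]
  rfl

lemma shA_nonneg (n : ℕ) : 0 ≤ shA n := by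
  by_cases h : n ∈ Set.range (fun k : ℕ => 2 ^ 2 ^ k : ℕ → ℕ)
  · obtain ⟨k, rfl⟩ := h
    simp only [shA_apply]
    positivity
  · rw [shA_zero n h]

lemma sh_term (δ : ℝ) (k : ℕ) :
    shA (2 ^ 2 ^ k) / (((2 ^ 2 ^ k : ℕ) : ℝ)) ^ (1 + δ)
      = 2 ^ k * ((2 : ℝ) ^ (-δ)) ^ 2 ^ k := by
  have h2 : (0 : ℝ) < 2 ^ 2 ^ k := by positivity
  have e : ((2 : ℝ) ^ (-δ)) ^ 2 ^ k = (((2 : ℝ) ^ 2 ^ k) ^ δ)⁻¹ := by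
    rw [← Real.rpow_neg h2.le, ← Real.rpow_natCast, ← Real.rpow_natCast,
      ← Real.rpow_mul (by norm_num), ← Real.rpow_mul (by norm_num), mul_comm]
  rw [shA_apply, e]
  push_cast
  rw [Real.rpow_add h2, Real.rpow_one]
  have : (0 : ℝ) < ((2 : ℝ) ^ 2 ^ k) ^ δ := by positivity
  field_simp

lemma sh_partial (r : ℝ) (h0 : 0 < r) (h1 : r < 1) (n : ℕ) :
    ∑ k ∈ range n, 2 ^ k * r ^ 2 ^ k ≤ 2 / (1 - r) := by
  have hle : ∑ k ∈ range n, 2 ^ k * r ^ 2 ^ k ≤ ∑ k ∈ range (n + 1), 2 ^ k * r ^ 2 ^ k := by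
    rw [Finset.sum_range_succ]
    have : 0 ≤ 2 ^ n * r ^ 2 ^ n := by positivity
    linarith
  refine hle.trans ?_
  have hc := Finset.sum_condensed_le (f := fun j : ℕ => r ^ j)
    (fun m n _ hmn => pow_le_pow_of_le_one h0.le h1.le hmn) n
  simp only [nsmul_eq_mul, Nat.cast_pow, Nat.cast_ofNat, pow_one] at hc
  refine hc.trans ?_
  have hg : ∑ k ∈ insert 1 (Ico 2 (2 ^ n + 1)), r ^ k ≤ 1 / (1 - r) := by
    rw [one_div, ← tsum_geometric_of_lt_one h0.le h1]
    exact (summable_geometric_of_lt_one h0.le h1).sum_le_tsum _ (fun i _ => by positivity)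
  rw [Finset.sum_insert (by simp), pow_one] at hg
  have : 2 / (1 - r) = 2 * (1 / (1 - r)) := by ring
  rw [this]
  linarith

lemma sh_r (δ : ℝ) (hδ : 0 < δ) : (0 : ℝ) < 2 ^ (-δ) ∧ (2 : ℝ) ^ (-δ) < 1 :=
  ⟨by positivity, Real.rpow_lt_one_of_one_lt_of_neg (by norm_num) (by linarith)⟩

lemma sh_summable_k (δ : ℝ) (hδ : 0 < δ) :
    Summable (fun k : ℕ => 2 ^ k * ((2 : ℝ) ^ (-δ)) ^ 2 ^ k) :=
  summable_of_sum_range_le (fun k => by positivity)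
    (sh_partial _ (sh_r δ hδ).1 (sh_r δ hδ).2)

lemma sh_summable (δ : ℝ) (hδ : 0 < δ) :
    Summable (fun n : ℕ => shA n / (n : ℝ) ^ (1 + δ)) := by
  rw [← sh_inj.summable_iff (fun n hn => by simp [shA_zero n hn])]
  exact (sh_summable_k δ hδ).congr (fun k => (sh_term δ k).symm)

lemma sh_bound (δ : ℝ) (hδ : 0 < δ) (hδ1 : δ < 1) :
    (∑' n : ℕ, shA n / (n : ℝ) ^ (1 + δ)) ≤ (4 / Real.log 2) / δ := by
  rw [← sh_inj.tsum_eq (f := fun n : ℕ => shA n / (n : ℝ) ^ (1 + δ))]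
  · have h : (∑' k : ℕ, shA (2 ^ 2 ^ k) / (((2 ^ 2 ^ k : ℕ) : ℝ)) ^ (1 + δ)) ≤
        2 / (1 - (2 : ℝ) ^ (-δ)) := by
      simp_rw [sh_term]
      exact Real.tsum_le_of_sum_range_le (fun k => by positivity)
        (sh_partial _ (sh_r δ hδ).1 (sh_r δ hδ).2)
    refine h.trans ?_
    have hl : 0 < Real.log 2 := Real.log_pos (by norm_num)
    have hl1 : Real.log 2 < 1 := by linarith [Real.log_two_lt_d9]
    set t := Real.log 2 * δ with ht
    have ht0 : 0 < t := by positivity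
    have ht1 : t < 1 := by nlinarith
    have hr : (2 : ℝ) ^ (-δ) ≤ 1 / (1 + t) := by
      rw [Real.rpow_def_of_pos (by norm_num), mul_neg, Real.exp_neg, ← ht, ← one_div]
      apply one_div_le_one_div_of_le (by linarith)
      linarith [Real.add_one_le_exp t]
    have hr2 : 1 / (1 + t) ≤ 1 - t / 2 := by
      rw [div_le_iff₀ (by linarith)]
      nlinarith
    rw [div_div, ← ht, div_le_div_iff₀ (by linarith) ht0]
    linarith
  · intro n hn
    by_contra h
    exact hn (by simp [shA_zero n h])

lemma sh_upper : ∀ᶠ N : ℕ in atTop,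
    (∑ n ∈ Finset.Icc 1 N, shA n) / (N * Real.log N) ≤ Real.exp 1 * (4 / Real.log 2) := by
  have hlog : Tendsto (fun N : ℕ => Real.log N) atTop atTop :=
    Real.tendsto_log_atTop.comp tendsto_natCast_atTop_atTop
  filter_upwards [hlog.eventually_gt_atTop 1, eventually_gt_atTop 0] with N hN hN0
  have hNr : (0 : ℝ) < N := by exact_mod_cast hN0
  have hL : 0 < Real.log N := by linarith
  set δ := 1 / Real.log N with hδ
  have hδ0 : 0 < δ := by positivity
  have hδ1 : δ < 1 := by rw [hδ, div_lt_one hL]; exact hN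
  have hpow : (N : ℝ) ^ (1 + δ) = N * Real.exp 1 := by
    rw [Real.rpow_add hNr, Real.rpow_one, Real.rpow_def_of_pos hNr, hδ, mul_one_div_cancel hL.ne']
  have h1 : (∑ n ∈ Finset.Icc 1 N, shA n) ≤
      (N : ℝ) ^ (1 + δ) * ∑ n ∈ Finset.Icc 1 N, shA n / (n : ℝ) ^ (1 + δ) := by
    rw [Finset.mul_sum]
    apply Finset.sum_le_sum
    intro n hn
    rw [Finset.mem_Icc] at hn
    have hn0 : (0 : ℝ) < n := by exact_mod_cast hn.1
    have hp : (0 : ℝ) < (n : ℝ) ^ (1 + δ) := by positivity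
    rw [mul_div_assoc', le_div_iff₀ hp, mul_comm]
    apply mul_le_mul_of_nonneg_right _ (shA_nonneg n)
    exact Real.rpow_le_rpow hn0.le (by exact_mod_cast hn.2) (by linarith)
  have h2 : ∑ n ∈ Finset.Icc 1 N, shA n / (n : ℝ) ^ (1 + δ) ≤ (4 / Real.log 2) / δ :=
    ((sh_summable δ hδ0).sum_le_tsum _
      (fun n _ => div_nonneg (shA_nonneg n) (by positivity))).trans (sh_bound δ hδ0 hδ1)
  rw [div_le_iff₀ (by positivity)]
  calc _ ≤ _ := h1
    _ ≤ (N : ℝ) ^ (1 + δ) * ((4 / Real.log 2) / δ) := by gcongr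
    _ = _ := by
      rw [hpow, hδ, div_div_eq_mul_div, div_one]
      ring

lemma sh_lower (k : ℕ) : 1 / Real.log 2 ≤
    (∑ n ∈ Finset.Icc 1 (2 ^ 2 ^ k), shA n) /
      (((2 ^ 2 ^ k : ℕ) : ℝ) * Real.log ((2 ^ 2 ^ k : ℕ) : ℝ)) := by
  have hl : 0 < Real.log 2 := Real.log_pos (by norm_num)
  have h : shA (2 ^ 2 ^ k) ≤ ∑ n ∈ Finset.Icc 1 (2 ^ 2 ^ k), shA n :=
    Finset.single_le_sum (f := shA) (fun n _ => shA_nonneg n)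
      (Finset.mem_Icc.2 ⟨Nat.one_le_two_pow, le_rfl⟩)
  rw [shA_apply] at h
  push_cast
  rw [Real.log_pow]
  push_cast
  rw [div_le_div_iff₀ hl (by positivity)]
  nlinarith

/-- Sharpness of the `O(N log N)` estimate: there is a nonnegative sequence whose
Dirichlet series converges for real `x > 1` with `f(x) = O(1/(x-1))` as `x ↘ 1`,
while `limsup_{N→∞} s_N/(N log N) ≥ 1/log 2 > 0`. -/
theorem sharpness_NlogN_estimate :
    ∃ a : ℕ → ℝ, (∀ n, 0 ≤ a n) ∧
      (∀ x : ℝ, 1 < x → Summable (fun n : ℕ => a n / (n : ℝ) ^ x)) ∧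
      (∃ C : ℝ, 0 < C ∧ ∃ δ₀ : ℝ, δ₀ ∈ Set.Ioo (0 : ℝ) 1 ∧
        ∀ δ : ℝ, δ ∈ Set.Ioo (0 : ℝ) δ₀ →
          (∑' n : ℕ, a n / (n : ℝ) ^ (1 + δ)) ≤ C / δ) ∧
      (0 < 1 / Real.log 2 ∧
        1 / Real.log 2 ≤
          Filter.limsup
            (fun N : ℕ => (∑ n ∈ Finset.Icc 1 N, a n) / (N * Real.log N)) atTop) := by
  have hl : 0 < Real.log 2 := Real.log_pos (by norm_num)
  refine ⟨shA, shA_nonneg, ?_, ⟨4 / Real.log 2, by positivity, 1 / 2, by norm_num, ?_⟩,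
    by positivity, ?_⟩
  · intro x hx
    have := sh_summable (x - 1) (by linarith)
    rwa [add_sub_cancel] at this
  · intro δ hδ
    exact sh_bound δ hδ.1 (by linarith [hδ.2])
  · apply Filter.le_limsup_of_frequently_le
    · rw [Filter.frequently_atTop]
      intro m
      refine ⟨2 ^ 2 ^ m, ?_, sh_lower m⟩
      exact (Nat.lt_two_pow_self.trans Nat.lt_two_pow_self).le
    · exact Filter.isBoundedUnder_of_eventually_le sh_upper
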